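/- arXiv:1906.04071 — 5 statements merged into one kernel-verified Lean document; each statement's English description precedes it below -/
import Mathlib

section
/- For all integers i, j ≥ 0, the integral ∫₀¹ P_i(c) (∫₀^c P_j(x) dx) dc equals ξ₀ = 1/2 if i = j = 0, equals ξ_i if j = i − 1, equals −ξ_{i+1} if j = i + 1, and equals 0 in all other cases. -/
open MeasureTheory intervalIntegral

/-- The integral over `[0, 1]` as a linear functional on real polynomials. -/
noncomputable def unitIntegral : Polynomial ℝ →ₗ[ℝ] ℝ where
  toFun p := ∫ x in (0:ℝ)..1, p.eval x
  map_add' p q := by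
    simp only [Polynomial.eval_add]
    exact integral_add (p.continuous.intervalIntegrable _ _) (q.continuous.intervalIntegrable _ _)
  map_smul' c p := by simp

theorem unitIntegral_apply (p : Polynomial ℝ) :
    unitIntegral p = ∫ x in (0:ℝ)..1, p.eval x := rfl

theorem integral_eval_derivative (p : Polynomial ℝ) (a b : ℝ) :
    ∫ x in a..b, p.derivative.eval x = p.eval b - p.eval a :=
  integral_eq_sub_of_hasDerivAt (fun x _ => p.hasDerivAt x)
    (p.derivative.continuous.intervalIntegrable _ _)

theorem unitIntegral_derivative (p : Polynomial ℝ) :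
    unitIntegral p.derivative = p.eval 1 - p.eval 0 :=
  integral_eval_derivative p 0 1

/-- Every real polynomial has an antiderivative vanishing at `0`. -/
theorem exists_polynomial_antiderivative (p : Polynomial ℝ) :
    ∃ F : Polynomial ℝ, F.derivative = p ∧ F.eval 0 = 0 ∧
      ∀ n, F.coeff (n + 1) = p.coeff n / (n + 1) := by
  induction p using Polynomial.induction_on' with
  | add p q hp hq =>
    obtain ⟨F, hF, hF0, hFc⟩ := hp
    obtain ⟨G, hG, hG0, hGc⟩ := hq
    refine ⟨F + G, by simp [hF, hG], by simp [hF0, hG0], fun n => ?_⟩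
    rw [Polynomial.coeff_add, hFc, hGc, Polynomial.coeff_add, add_div]
  | monomial m a =>
    have hm : (m : ℝ) + 1 ≠ 0 := by positivity
    refine ⟨Polynomial.monomial (m + 1) (a / (m + 1)), ?_, by simp, fun n => ?_⟩
    · rw [Polynomial.derivative_monomial]
      congr 1
      push_cast
      field_simp
    · simp only [Polynomial.coeff_monomial, Nat.add_right_cancel_iff]
      split_ifs with h
      · rw [h]
      · simp

/-- Polynomials of degree `0, 1, 2, …` with positive leading coefficients that are orthonormal
on `[0, 1]`, that is, the shifted Legendre polynomials. -/
structure IsUnitOrthonormal (P : ℕ → Polynomial ℝ) : Prop where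
  degree_eq : ∀ j, (P j).degree = j
  leadingCoeff_pos : ∀ j, 0 < (P j).leadingCoeff
  unitIntegral_mul : ∀ i j, unitIntegral (P i * P j) = if i = j then 1 else 0

namespace IsUnitOrthonormal

variable {P : ℕ → Polynomial ℝ}

theorem coeff_self_pos (h : IsUnitOrthonormal P) (n : ℕ) : 0 < (P n).coeff n := by
  have := h.leadingCoeff_pos n
  rwa [Polynomial.leadingCoeff, Polynomial.natDegree_eq_of_degree_eq_some (h.degree_eq n)] at this

theorem degree_sub_lt (h : IsUnitOrthonormal P) {q : Polynomial ℝ} {m : ℕ}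
    (hq : q.degree < (m + 1 : ℕ)) :
    (q - (q.coeff m / (P m).coeff m) • P m).degree < m := by
  rw [Polynomial.degree_lt_iff_coeff_zero] at hq ⊢
  intro k hk
  rw [Polynomial.coeff_sub, Polynomial.coeff_smul, smul_eq_mul]
  rcases hk.eq_or_lt with rfl | hk
  · rw [div_mul_cancel₀ _ (h.coeff_self_pos m).ne', sub_self]
  · have hPk : (P m).coeff k = 0 := by
      apply Polynomial.coeff_eq_zero_of_degree_lt
      rw [h.degree_eq]
      exact_mod_cast hk
    rw [hq k hk, hPk, mul_zero, sub_zero]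

theorem unitIntegral_mul_eq (h : IsUnitOrthonormal P) (q : Polynomial ℝ) (n m : ℕ) :
    unitIntegral (P n * q) = unitIntegral (P n * (q - (q.coeff m / (P m).coeff m) • P m)) +
      q.coeff m / (P m).coeff m * if n = m then 1 else 0 := by
  rw [mul_sub, map_sub, mul_smul_comm, map_smul, h.unitIntegral_mul, smul_eq_mul, sub_add_cancel]

theorem unitIntegral_mul_of_degree_lt (h : IsUnitOrthonormal P) {m n : ℕ} (hmn : m ≤ n)
    {q : Polynomial ℝ} (hq : q.degree < m) : unitIntegral (P n * q) = 0 := by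
  induction m generalizing q with
  | zero =>
    have : q = 0 := by
      ext k
      exact (Polynomial.degree_lt_iff_coeff_zero q 0).1 hq k k.zero_le
    simp [this]
  | succ m ih =>
    rw [h.unitIntegral_mul_eq q n m, ih (by omega) (h.degree_sub_lt hq), if_neg (by omega)]
    simp

theorem unitIntegral_mul_of_degree_lt_succ (h : IsUnitOrthonormal P) {n : ℕ}
    {q : Polynomial ℝ} (hq : q.degree < (n + 1 : ℕ)) :
    unitIntegral (P n * q) = q.coeff n / (P n).coeff n := by
  rw [h.unitIntegral_mul_eq q n n, h.unitIntegral_mul_of_degree_lt le_rfl (h.degree_sub_lt hq)]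
  simp

theorem degree_derivative_lt (h : IsUnitOrthonormal P) (n : ℕ) :
    (P n).derivative.degree < n := by
  rw [← h.degree_eq n]
  refine Polynomial.degree_derivative_lt fun h0 => ?_
  simpa [h0] using h.leadingCoeff_pos n

theorem unitIntegral_mul_derivative_self (h : IsUnitOrthonormal P) (n : ℕ) :
    unitIntegral (P n * (P n).derivative) = 0 :=
  h.unitIntegral_mul_of_degree_lt le_rfl (h.degree_derivative_lt n)

theorem eval_zero_sq_eq (h : IsUnitOrthonormal P) (n : ℕ) :
    (P n).eval 0 ^ 2 = (P n).eval 1 ^ 2 := by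
  have key := unitIntegral_derivative (P n * P n)
  rw [Polynomial.derivative_mul, map_add, mul_comm (P n).derivative,
    h.unitIntegral_mul_derivative_self, Polynomial.eval_mul, Polynomial.eval_mul] at key
  linarith

theorem eval_one_sq (h : IsUnitOrthonormal P) (n : ℕ) : (P n).eval 1 ^ 2 = 2 * n + 1 := by
  have hX : unitIntegral (P n * (Polynomial.X * (P n).derivative)) = n := by
    rw [h.unitIntegral_mul_of_degree_lt_succ, div_eq_iff (h.coeff_self_pos n).ne']
    · cases n with
      | zero => simp
      | succ k =>
        rw [Polynomial.coeff_X_mul, Polynomial.coeff_derivative]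
        push_cast
        ring
    · rw [Polynomial.degree_lt_iff_coeff_zero]
      rintro (_ | k) hk
      · omega
      · rw [Polynomial.coeff_X_mul]
        exact (Polynomial.degree_lt_iff_coeff_zero _ n).1 (h.degree_derivative_lt n) k (by omega)
  have key := unitIntegral_derivative (Polynomial.X * (P n * P n))
  have e : (Polynomial.X * (P n * P n)).derivative =
      P n * P n + (2 : ℝ) • (P n * (Polynomial.X * (P n).derivative)) := by
    rw [two_smul, Polynomial.derivative_mul, Polynomial.derivative_mul, Polynomial.derivative_X]
    ring
  rw [e, map_add, map_smul, hX, h.unitIntegral_mul, if_pos rfl] at key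
  simp only [smul_eq_mul, Polynomial.eval_mul, Polynomial.eval_X] at key
  linarith

/-- The ratio of consecutive leading coefficients. -/
theorem coeff_ratio (h : IsUnitOrthonormal P) (n : ℕ) :
    (P (n + 1)).coeff (n + 1) * (n + 1) / (P n).coeff n =
      2 * √((2 * n + 1) * (2 * n + 3)) := by
  set r := (P (n + 1)).coeff (n + 1) * (n + 1) / (P n).coeff n with hr
  have hpos : 0 < r :=
    div_pos (mul_pos (h.coeff_self_pos _) (by positivity)) (h.coeff_self_pos n)
  have key := unitIntegral_derivative (P (n + 1) * P n)
  rw [Polynomial.derivative_mul, map_add, mul_comm (P (n + 1)).derivative,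
    h.unitIntegral_mul_of_degree_lt_succ (h.degree_derivative_lt (n + 1)),
    h.unitIntegral_mul_of_degree_lt n.le_succ (h.degree_derivative_lt n),
    Polynomial.coeff_derivative, ← hr, add_zero] at key
  simp only [Polynomial.eval_mul] at key
  have hu : ((P (n + 1)).eval 1 * (P n).eval 1) ^ 2 = (2 * n + 1) * (2 * n + 3) := by
    rw [mul_pow, h.eval_one_sq, h.eval_one_sq]
    push_cast
    ring
  have hv : ((P (n + 1)).eval 0 * (P n).eval 0) ^ 2 =
      ((P (n + 1)).eval 1 * (P n).eval 1) ^ 2 := by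
    rw [mul_pow, h.eval_zero_sq_eq, h.eval_zero_sq_eq, mul_pow]
  generalize (P (n + 1)).eval 1 * (P n).eval 1 = u at *
  generalize (P (n + 1)).eval 0 * (P n).eval 0 = v at *
  rcases sq_eq_sq_iff_eq_or_eq_neg.1 hv with rfl | rfl
  · linarith
  · rw [← hu, Real.sqrt_sq (by linarith)]
    linarith

theorem unitIntegral_eq (h : IsUnitOrthonormal P) (n : ℕ) :
    unitIntegral (P n) = if n = 0 then 1 else 0 := by
  split_ifs with hn
  · subst hn
    have hC := Polynomial.eq_C_of_degree_eq_zero (h.degree_eq 0)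
    have h1 := h.eval_one_sq 0
    have hpos := h.coeff_self_pos 0
    rw [hC, Polynomial.eval_C] at h1
    have h2 : (P 0).coeff 0 = 1 := by
      push_cast at h1
      nlinarith
    rw [hC, h2, unitIntegral_apply]
    simp
  · have := h.unitIntegral_mul_of_degree_lt (n := n) (m := 1) (q := 1) (by omega)
      (by rw [Polynomial.degree_one]; exact_mod_cast Nat.zero_lt_one)
    rwa [mul_one] at this

variable {F : ℕ → Polynomial ℝ}

theorem unitIntegral_mul_antiderivative_add (h : IsUnitOrthonormal P)
    (hF : ∀ j, (F j).derivative = P j) (hF0 : ∀ j, (F j).eval 0 = 0) (i j : ℕ) :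
    unitIntegral (P i * F j) + unitIntegral (P j * F i) = if i = 0 ∧ j = 0 then 1 else 0 := by
  have hF1 : ∀ j, (F j).eval 1 = if j = 0 then 1 else 0 := fun j => by
    rw [← h.unitIntegral_eq j, ← hF j, unitIntegral_derivative, hF0, sub_zero]
  have key := unitIntegral_derivative (F i * F j)
  rw [Polynomial.derivative_mul, hF, hF, map_add, mul_comm (F i)] at key
  rw [key, Polynomial.eval_mul, Polynomial.eval_mul, hF0, hF1, hF1]
  split_ifs <;> simp_all

theorem degree_antiderivative_lt (h : IsUnitOrthonormal P)
    (hFc : ∀ j n, (F j).coeff (n + 1) = (P j).coeff n / (n + 1)) (j : ℕ) :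
    (F j).degree < (j + 2 : ℕ) := by
  rw [Polynomial.degree_lt_iff_coeff_zero]
  rintro (_ | k) hk
  · omega
  · rw [hFc, Polynomial.coeff_eq_zero_of_degree_lt, zero_div]
    rw [h.degree_eq]
    exact_mod_cast (by omega : j < k)

theorem unitIntegral_succ_mul_antiderivative (h : IsUnitOrthonormal P)
    (hFc : ∀ j n, (F j).coeff (n + 1) = (P j).coeff n / (n + 1)) (n : ℕ) :
    unitIntegral (P (n + 1) * F n) = 1 / (2 * √|4 * ((n + 1 : ℕ) : ℝ) ^ 2 - 1|) := by
  have e : 4 * ((n + 1 : ℕ) : ℝ) ^ 2 - 1 = (2 * n + 1) * (2 * n + 3) := by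
    push_cast
    ring
  rw [h.unitIntegral_mul_of_degree_lt_succ (h.degree_antiderivative_lt hFc n), hFc, e,
    abs_of_nonneg (by positivity), ← h.coeff_ratio n]
  have h1 := (h.coeff_self_pos n).ne'
  have h2 := (h.coeff_self_pos (n + 1)).ne'
  field_simp

end IsUnitOrthonormal

/-- For the shifted Legendre polynomials, the integral
`∫₀¹ P_i(c) (∫₀^c P_j) dc` equals `ξ₀ = 1/2` if `i = j = 0`, `ξ_i` if `j = i − 1`,
`−ξ_{i+1}` if `j = i + 1`, and `0` otherwise. -/
theorem stmt1 (P : ℕ → Polynomial ℝ)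
    (hdeg : ∀ j, (P j).degree = j)
    (hlead : ∀ j, 0 < (P j).leadingCoeff)
    (horth : ∀ i j, (∫ x in (0:ℝ)..1, (P i).eval x * (P j).eval x)
      = if i = j then 1 else 0)
    (ξ : ℕ → ℝ)
    (hξ : ∀ i, ξ i = 1 / (2 * Real.sqrt |4 * (i : ℝ)^2 - 1|)) :
    ξ 0 = 1 / 2 ∧
    ∀ i j : ℕ, (∫ c in (0:ℝ)..1, (P i).eval c * ∫ x in (0:ℝ)..c, (P j).eval x)
      = if i = 0 ∧ j = 0 then ξ 0
        else if j + 1 = i then ξ i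
        else if j = i + 1 then -ξ (i+1)
        else 0 := by
  have hξ0 : ξ 0 = 1 / 2 := by simp [hξ]
  refine ⟨hξ0, fun i j => ?_⟩
  have h : IsUnitOrthonormal P :=
    ⟨hdeg, hlead, fun i j => by simpa [unitIntegral_apply] using horth i j⟩
  choose F hF hF0 hFc using fun j => exists_polynomial_antiderivative (P j)
  have hint : (∫ c in (0:ℝ)..1, (P i).eval c * ∫ x in (0:ℝ)..c, (P j).eval x) =
      unitIntegral (P i * F j) := by
    rw [unitIntegral_apply]
    congr 1
    ext c
    rw [Polynomial.eval_mul, ← hF j, integral_eval_derivative, hF0, sub_zero]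
  have hsum := h.unitIntegral_mul_antiderivative_add hF hF0 i j
  have hzero : ∀ i j, j + 2 ≤ i → unitIntegral (P i * F j) = 0 := fun i j hij =>
    h.unitIntegral_mul_of_degree_lt hij (h.degree_antiderivative_lt hFc j)
  have hsucc : ∀ n, unitIntegral (P (n + 1) * F n) = ξ (n + 1) := fun n => by
    rw [hξ, h.unitIntegral_succ_mul_antiderivative hFc]
  rw [hint]
  split_ifs with h0 h1 h2
  · rw [if_pos h0, h0.1, h0.2] at hsum
    rw [h0.1, h0.2, hξ0]
    linarith
  · subst h1
    exact hsucc j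
  · subst h2
    rw [if_neg h0, hsucc] at hsum
    linarith
  · rw [if_neg h0] at hsum
    rcases lt_trichotomy i j with hij | rfl | hij
    · linarith [hzero j i (by omega)]
    · linarith
    · exact hzero i j (by omega)
end

section
/- For every integer s ≥ 1 and all c, τ ∈ [0,1], the kernel a^{(s)}_{cτ} := Σ_{j=0}^{s−1} (∫₀^c P_j(x) dx) P_j(τ) satisfies a^{(s)}_{cτ} = c + Σ_{j=1}^{s−1} [ξ_{j+1} P_{j+1}(c) − ξ_j P_{j−1}(c)] P_j(τ). -/
open MeasureTheory intervalIntegral Finset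

namespace Polynomial

/-- Integration of real polynomials over `[0,1]`, as a linear functional. -/
noncomputable def unitIntegral : ℝ[X] →ₗ[ℝ] ℝ where
  toFun p := ∫ x in (0:ℝ)..1, p.eval x
  map_add' p q := by
    simp only [eval_add]
    exact integral_add (p.continuous.intervalIntegrable _ _) (q.continuous.intervalIntegrable _ _)
  map_smul' r p := by
    simp only [eval_smul, smul_eq_mul, RingHom.id_apply, intervalIntegral.integral_const_mul]

theorem integral_eval_derivative (p : ℝ[X]) (a b : ℝ) :
    ∫ x in a..b, (derivative p).eval x = p.eval b - p.eval a :=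
  integral_eq_sub_of_hasDerivAt (fun x _ => p.hasDerivAt x)
    ((derivative p).continuous.intervalIntegrable _ _)

theorem unitIntegral_derivative (p : ℝ[X]) :
    unitIntegral (derivative p) = p.eval 1 - p.eval 0 :=
  integral_eval_derivative p 0 1

/-- Every real polynomial has a primitive vanishing at the origin. -/
theorem exists_derivative_eq (p : ℝ[X]) : ∃ q : ℝ[X], derivative q = p ∧ q.eval 0 = 0 := by
  induction p using Polynomial.induction_on' with
  | add p q hp hq =>
    obtain ⟨u, hu, hu0⟩ := hp
    obtain ⟨v, hv, hv0⟩ := hq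
    exact ⟨u + v, by simp [hu, hv], by simp [hu0, hv0]⟩
  | monomial n a =>
    refine ⟨monomial (n + 1) (a / (n + 1)), ?_, by simp [eval_monomial]⟩
    have h : (n : ℝ) + 1 ≠ 0 := by positivity
    simp [div_mul_cancel₀ a h]

theorem coeff_succ_of_derivative_eq {p q : ℝ[X]} (h : derivative q = p) (n : ℕ) :
    q.coeff (n + 1) = p.coeff n / (n + 1) := by
  have hn : (n : ℝ) + 1 ≠ 0 := by positivity
  rw [eq_div_iff hn, ← h, coeff_derivative]

section Orthonormal

variable {P : ℕ → ℝ[X]}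

theorem eq_sum_unitIntegral_mul (hdeg : ∀ j, (P j).degree = j)
    (horth : ∀ i j, unitIntegral (P i * P j) = if i = j then 1 else 0) (n : ℕ) :
    ∀ p : ℝ[X], p.degree < n → p = ∑ i ∈ range n, unitIntegral (p * P i) • P i := by
  induction n with
  | zero =>
    intro p hp
    simpa using hp
  | succ n ih =>
    intro p hp
    have hk : (P n).coeff n ≠ 0 := coeff_ne_zero_of_eq_degree (hdeg n)
    set a := p.coeff n / (P n).coeff n with ha
    have hr : (p - a • P n).degree < n := by
      rw [degree_lt_iff_coeff_zero] at hp ⊢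
      intro m hm
      rcases hm.eq_or_lt with rfl | hm
      · simp [ha, div_mul_cancel₀ _ hk]
      · have hP : (P n).coeff m = 0 :=
          coeff_eq_zero_of_degree_lt (by rw [hdeg]; exact_mod_cast hm)
        simp [hp m hm, hP]
    have hsum := ih _ hr
    have hlow : ∀ i ∈ range n,
        unitIntegral ((p - a • P n) * P i) • P i = unitIntegral (p * P i) • P i := by
      intro i hi
      have : n ≠ i := (mem_range.1 hi).ne'
      simp [sub_mul, horth, this]
    have hzero : unitIntegral ((p - a • P n) * P n) = 0 := by
      rw [hsum, sum_mul, map_sum]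
      refine sum_eq_zero fun i hi => ?_
      have : i ≠ n := (mem_range.1 hi).ne
      simp [horth, this]
    have hpa : unitIntegral (p * P n) = a := by
      simpa [sub_mul, horth, sub_eq_zero] using hzero
    rw [sum_range_succ, ← sum_congr rfl hlow, ← hsum, hpa]
    simp

theorem unitIntegral_mul_eq_coeff_div (hdeg : ∀ j, (P j).degree = j)
    (horth : ∀ i j, unitIntegral (P i * P j) = if i = j then 1 else 0) {n : ℕ} {p : ℝ[X]}
    (hp : p.degree < (n + 1 : ℕ)) : unitIntegral (p * P n) = p.coeff n / (P n).coeff n := by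
  have hk : (P n).coeff n ≠ 0 := coeff_ne_zero_of_eq_degree (hdeg n)
  have h := congrArg (fun q : ℝ[X] => q.coeff n) (eq_sum_unitIntegral_mul hdeg horth _ p hp)
  have h0 : ∑ i ∈ range n, unitIntegral (p * P i) * (P i).coeff n = 0 := by
    refine sum_eq_zero fun i hi => ?_
    rw [coeff_eq_zero_of_degree_lt (p := P i) (by rw [hdeg]; exact_mod_cast mem_range.1 hi),
      mul_zero]
  simp only [sum_range_succ, coeff_add, finsetSum_coeff, coeff_smul, smul_eq_mul, h0,
    zero_add] at h
  rw [eq_div_iff hk, h]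

theorem sq_eval_one_of_orthonormal (hdeg : ∀ j, (P j).degree = j)
    (horth : ∀ i j, unitIntegral (P i * P j) = if i = j then 1 else 0) (j : ℕ) :
    (P j).eval 1 ^ 2 = 2 * j + 1 := by
  have hk : (P j).coeff j ≠ 0 := coeff_ne_zero_of_eq_degree (hdeg j)
  have hcoeff : ∀ m, (X * derivative (P j)).coeff m = m * (P j).coeff m := by
    rintro (_ | m)
    · simp
    · rw [coeff_X_mul, coeff_derivative]
      push_cast
      ring
  have hd : (X * derivative (P j)).degree < ((j + 1 : ℕ) : WithBot ℕ) := by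
    rw [degree_lt_iff_coeff_zero]
    intro m hm
    rw [hcoeff, coeff_eq_zero_of_degree_lt (by rw [hdeg]; exact_mod_cast hm), mul_zero]
  have h := unitIntegral_derivative (X * (P j * P j))
  have he : derivative (X * (P j * P j))
      = P j * P j + (2 : ℝ) • (X * derivative (P j) * P j) := by
    simp only [derivative_mul, derivative_X, smul_eq_C_mul, C_ofNat]
    ring
  rw [he, map_add, map_smul, horth, unitIntegral_mul_eq_coeff_div hdeg horth hd, hcoeff,
    mul_div_cancel_right₀ _ hk] at h
  simp at h
  linarith

theorem eq_one_of_orthonormal (hdeg : ∀ j, (P j).degree = j)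
    (hlead : ∀ j, 0 < (P j).leadingCoeff)
    (horth : ∀ i j, unitIntegral (P i * P j) = if i = j then 1 else 0) : P 0 = 1 := by
  have hC : P 0 = C ((P 0).coeff 0) := eq_C_of_degree_le_zero (by simp [hdeg])
  have hpos : 0 < (P 0).coeff 0 := by
    have h := hlead 0
    rwa [leadingCoeff, natDegree_eq_of_degree_eq_some (hdeg 0)] at h
  have hsq := sq_eval_one_of_orthonormal hdeg horth 0
  rw [hC, eval_C] at hsq
  have : (P 0).coeff 0 = 1 := by
    norm_num at hsq
    rcases hsq with h | h <;> linarith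
  rw [hC, this, C_1]

/-- The leading coefficient, relative to `P (j + 1)`, of a primitive of `P j`. -/
noncomputable def primitiveRatio (P : ℕ → ℝ[X]) (j : ℕ) : ℝ :=
  (P j).coeff j / (j + 1) / (P (j + 1)).coeff (j + 1)

theorem unitIntegral_primitive_mul (hdeg : ∀ j, (P j).degree = j)
    (horth : ∀ i j, unitIntegral (P i * P j) = if i = j then 1 else 0) {j n : ℕ} (hjn : j < n)
    {q : ℝ[X]} (hq : derivative q = P j) :
    unitIntegral (q * P n) = if n = j + 1 then primitiveRatio P j else 0 := by
  have hz : ∀ m, j < m → q.coeff (m + 1) = 0 := by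
    intro m hm
    rw [coeff_succ_of_derivative_eq hq,
      coeff_eq_zero_of_degree_lt (by rw [hdeg]; exact_mod_cast hm), zero_div]
  have hd : q.degree < ((n + 1 : ℕ) : WithBot ℕ) := by
    rw [degree_lt_iff_coeff_zero]
    rintro (_ | m) hm
    · omega
    · exact hz m (by omega)
  rw [unitIntegral_mul_eq_coeff_div hdeg horth hd]
  split_ifs with h
  · subst h
    rw [coeff_succ_of_derivative_eq hq, primitiveRatio]
  · obtain ⟨m, rfl⟩ : ∃ m, n = m + 1 := ⟨n - 1, by omega⟩
    rw [hz m (by omega), zero_div]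

theorem primitive_eq (hdeg : ∀ j, (P j).degree = j)
    (hlead : ∀ j, 0 < (P j).leadingCoeff)
    (horth : ∀ i j, unitIntegral (P i * P j) = if i = j then 1 else 0) (j : ℕ)
    {q : ℝ[X]} (hq : derivative q = P (j + 1)) (hq0 : q.eval 0 = 0) :
    q.eval 1 = 0 ∧
      q = primitiveRatio P (j + 1) • P (j + 2) - primitiveRatio P j • P j := by
  have hq1 : q.eval 1 = 0 := by
    have h := unitIntegral_derivative q
    have h0 := horth 0 (j + 1)
    rw [eq_one_of_orthonormal hdeg hlead horth, one_mul] at h0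
    rw [hq, h0, hq0] at h
    simpa using h.symm
  have hparts : ∀ i, ∀ u : ℝ[X], derivative u = P i →
      unitIntegral (q * P i) = -unitIntegral (u * P (j + 1)) := by
    intro i u hu
    have h := unitIntegral_derivative (q * u)
    rw [derivative_mul, hq, hu, map_add, eval_mul, eval_mul, hq1, hq0, mul_comm (P (j + 1))] at h
    linarith
  have hd : q.degree < ((j + 3 : ℕ) : WithBot ℕ) := by
    rw [degree_lt_iff_coeff_zero]
    rintro (_ | m) hm
    · omega
    · rw [coeff_succ_of_derivative_eq hq,
        coeff_eq_zero_of_degree_lt (by rw [hdeg]; exact_mod_cast (by omega)), zero_div]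
  have hlow : ∀ i, i < j + 1 →
      unitIntegral (q * P i) = if i = j then -primitiveRatio P j else 0 := by
    intro i hi
    obtain ⟨u, hu, -⟩ := exists_derivative_eq (P i)
    rw [hparts i u hu, unitIntegral_primitive_mul hdeg horth hi hu]
    by_cases h : i = j
    · simp [h]
    · simp [h, Ne.symm h]
  have hmid : unitIntegral (q * P (j + 1)) = 0 := by
    have := hparts _ q hq
    linarith
  have htop := unitIntegral_primitive_mul hdeg horth (Nat.lt_succ_self (j + 1)) hq
  refine ⟨hq1, ?_⟩
  have hsum := eq_sum_unitIntegral_mul hdeg horth _ q hd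
  have hzero : ∑ i ∈ range j, unitIntegral (q * P i) • P i = 0 := by
    refine sum_eq_zero fun i hi => ?_
    have hi := mem_range.1 hi
    rw [hlow i (by omega), if_neg hi.ne, zero_smul]
  rw [sum_range_succ, sum_range_succ, sum_range_succ, hzero, hlow j (by omega), hmid, htop] at hsum
  simp only [if_true, zero_add, zero_smul, add_zero, neg_smul] at hsum
  rw [hsum]
  abel

theorem primitiveRatio_pos (hdeg : ∀ j, (P j).degree = j)
    (hlead : ∀ j, 0 < (P j).leadingCoeff) (j : ℕ) : 0 < primitiveRatio P j := by
  have hpos : ∀ i, 0 < (P i).coeff i := by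
    intro i
    have h := hlead i
    rwa [leadingCoeff, natDegree_eq_of_degree_eq_some (hdeg i)] at h
  have := hpos j
  have := hpos (j + 1)
  unfold primitiveRatio
  positivity

theorem sq_primitiveRatio (hdeg : ∀ j, (P j).degree = j)
    (hlead : ∀ j, 0 < (P j).leadingCoeff)
    (horth : ∀ i j, unitIntegral (P i * P j) = if i = j then 1 else 0) (j : ℕ) :
    primitiveRatio P j ^ 2 = 1 / (4 * ((2 * j + 1) * (2 * j + 3))) := by
  induction j with
  | zero =>
    have hP0 := eq_one_of_orthonormal hdeg hlead horth
    have hX : derivative (X : ℝ[X]) = P 0 := by rw [hP0, derivative_X]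
    have h1 := unitIntegral_primitive_mul hdeg horth zero_lt_one hX
    have h0 : unitIntegral (X * P 0) = 1 / 2 := by
      simp [hP0, unitIntegral]
    have hsum := eq_sum_unitIntegral_mul hdeg horth 2 X (by rw [degree_X]; norm_num)
    rw [sum_range_succ, sum_range_one, h1, h0, hP0] at hsum
    have he := congrArg (eval 1) hsum
    have hsq := sq_eval_one_of_orthonormal hdeg horth 1
    simp at he hsq
    have hr : primitiveRatio P 0 * (P 1).eval 1 = 1 / 2 := by linarith
    have hr2 : primitiveRatio P 0 ^ 2 * (P 1).eval 1 ^ 2 = 1 / 4 := by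
      rw [← mul_pow, hr]
      norm_num
    rw [hsq] at hr2
    norm_num at hr2 ⊢
    linarith
  | succ j ih =>
    obtain ⟨q, hq, hq0⟩ := exists_derivative_eq (P (j + 1))
    obtain ⟨hq1, hqe⟩ := primitive_eq hdeg hlead horth j hq hq0
    rw [hqe, eval_sub, eval_smul, eval_smul, smul_eq_mul, smul_eq_mul, sub_eq_zero] at hq1
    have h := congrArg (· ^ 2) hq1
    simp only [mul_pow, sq_eval_one_of_orthonormal hdeg horth, ih] at h
    push_cast at h ⊢
    field_simp at h ⊢
    nlinarith [h]

theorem primitiveRatio_eq (hdeg : ∀ j, (P j).degree = j)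
    (hlead : ∀ j, 0 < (P j).leadingCoeff)
    (horth : ∀ i j, unitIntegral (P i * P j) = if i = j then 1 else 0) (j : ℕ) :
    primitiveRatio P j = 1 / (2 * √|4 * ((j + 1 : ℕ) : ℝ) ^ 2 - 1|) := by
  have hE : 4 * ((j + 1 : ℕ) : ℝ) ^ 2 - 1 = (2 * j + 1) * (2 * j + 3) := by
    push_cast
    ring
  have hpos : (0 : ℝ) < (2 * j + 1) * (2 * j + 3) := by positivity
  rw [hE, abs_of_pos hpos]
  refine (sq_eq_sq₀ (primitiveRatio_pos hdeg hlead j).le (by positivity)).1 ?_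
  rw [sq_primitiveRatio hdeg hlead horth, div_pow, mul_pow, Real.sq_sqrt hpos.le]
  norm_num

end Orthonormal

end Polynomial

/-- For `s ≥ 1` and `c, τ ∈ [0,1]`, the continuous-stage RK kernel
`a^{(s)}_{cτ} = Σ_{j=0}^{s−1} (∫₀^c P_j) P_j(τ)` satisfies
`a^{(s)}_{cτ} = c + Σ_{j=1}^{s−1} [ξ_{j+1} P_{j+1}(c) − ξ_j P_{j−1}(c)] P_j(τ)`. -/
theorem stmt2 (P : ℕ → Polynomial ℝ)
    (hdeg : ∀ j, (P j).degree = j)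
    (hlead : ∀ j, 0 < (P j).leadingCoeff)
    (horth : ∀ i j, (∫ x in (0:ℝ)..1, (P i).eval x * (P j).eval x)
      = if i = j then 1 else 0)
    (ξ : ℕ → ℝ)
    (hξ : ∀ i, ξ i = 1 / (2 * Real.sqrt |4 * (i : ℝ)^2 - 1|))
    (s : ℕ) (hs : 1 ≤ s) :
    ∀ c ∈ Set.Icc (0:ℝ) 1, ∀ τ ∈ Set.Icc (0:ℝ) 1,
      (∑ j ∈ Finset.range s, (∫ x in (0:ℝ)..c, (P j).eval x) * (P j).eval τ)
        = c + ∑ j ∈ Finset.Icc 1 (s-1),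
            (ξ (j+1) * (P (j+1)).eval c - ξ j * (P (j-1)).eval c) * (P j).eval τ := by
  intro c _ τ _
  have horth' : ∀ i j, Polynomial.unitIntegral (P i * P j) = if i = j then 1 else 0 := by
    intro i j
    rw [← horth i j]
    simp only [Polynomial.unitIntegral, LinearMap.coe_mk, AddHom.coe_mk, Polynomial.eval_mul]
  have hratio : ∀ j, Polynomial.primitiveRatio P j = ξ (j + 1) := fun j => by
    rw [hξ, Polynomial.primitiveRatio_eq hdeg hlead horth']
  have hint : ∀ j, ∫ x in (0:ℝ)..c, (P (j + 1)).eval x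
      = ξ (j + 2) * (P (j + 2)).eval c - ξ (j + 1) * (P j).eval c := by
    intro j
    obtain ⟨q, hq, hq0⟩ := Polynomial.exists_derivative_eq (P (j + 1))
    rw [← hq, Polynomial.integral_eval_derivative, hq0, sub_zero,
      (Polynomial.primitive_eq hdeg hlead horth' j hq hq0).2, hratio, hratio]
    simp
  induction s, hs using Nat.le_induction with
  | base => simp [Polynomial.eq_one_of_orthonormal hdeg hlead horth']
  | succ n hn ih =>
    obtain ⟨m, rfl⟩ : ∃ m, n = m + 1 := ⟨n - 1, by omega⟩
    rw [sum_range_succ, ih, hint]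
    simp only [Nat.add_sub_cancel]
    rw [sum_Icc_succ_top (by omega)]
    simp only [Nat.add_sub_cancel]
    ring
end

section
/- Let s ≥ 1 be an integer, J an m×m real skew-symmetric matrix, H : ℝ^m → ℝ continuously differentiable, and set f(y) = J ∇H(y). Let y₀ ∈ ℝ^m, h > 0, and let σ : [0,h] → ℝ^m be continuous and satisfy the Master Functional Equation σ(ch) = y₀ + h Σ_{j=0}^{s−1} (∫₀^c P_j(x) dx) (∫₀¹ P_j(τ) f(σ(τh)) dτ) for all c ∈ [0,1]. Then the Hamiltonian is conserved: H(σ(h)) = H(y₀). -/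
open MeasureTheory intervalIntegral Finset

theorem Matrix.inner_toEuclideanLin_self_eq_zero {n : Type*} [Fintype n] [DecidableEq n]
    {A : Matrix n n ℝ} (hA : A.transpose = -A) (x : EuclideanSpace ℝ n) :
    inner ℝ x (Matrix.toEuclideanLin A x) = 0 := by
  have key : inner ℝ x (Matrix.toEuclideanLin A x) = - inner ℝ x (Matrix.toEuclideanLin A x) := by
    conv_lhs => rw [← LinearMap.adjoint_inner_left, ← Matrix.toEuclideanLin_conjTranspose_eq_adjoint,
      Matrix.conjTranspose_eq_transpose_of_trivial, hA, map_neg, LinearMap.neg_apply,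
      inner_neg_left, real_inner_comm]
  linarith

theorem ContDiff.continuous_gradient {E : Type*} [NormedAddCommGroup E] [InnerProductSpace ℝ E]
    [CompleteSpace E] {H : E → ℝ} (hH : ContDiff ℝ 1 H) : Continuous (gradient H) :=
  (InnerProductSpace.toDual ℝ E).symm.continuous.comp (hH.continuous_fderiv one_ne_zero)

/-- The line integral of `∇H` along `u` vanishes when `u'` is a combination of the `p j` whose
coefficients are the images, under a skew map, of the coefficients of `∇H ∘ u`. -/
theorem comp_eq_of_contDiff_of_hasDerivAt_sum_smul_skew {E : Type*} [NormedAddCommGroup E]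
    [InnerProductSpace ℝ E] [CompleteSpace E] {H : E → ℝ} (hH : ContDiff ℝ 1 H)
    (L : E →L[ℝ] E) (hL : ∀ x, inner ℝ x (L x) = 0) {ι : Type*} (t : Finset ι) {p : ι → ℝ → ℝ}
    (hp : ∀ j, Continuous (p j)) (a b h : ℝ) (u : ℝ → E)
    (hu : ∀ c, HasDerivAt u
      (h • ∑ j ∈ t, p j c • ∫ τ in a..b, p j τ • L (gradient H (u τ))) c) :
    H (u b) = H (u a) := by
  have hcu : Continuous u := continuous_iff_continuousAt.2 fun c => (hu c).continuousAt
  have hg : Continuous fun c => gradient H (u c) := hH.continuous_gradient.comp hcu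
  have hpg (j : ι) : Continuous fun c => p j c • gradient H (u c) := (hp j).smul hg
  have hcoeff (j : ι) : ∫ τ in a..b, p j τ • L (gradient H (u τ))
      = L (∫ τ in a..b, p j τ • gradient H (u τ)) := by
    rw [← L.intervalIntegral_comp_comm ((hpg j).intervalIntegrable a b)]
    simp
  simp only [hcoeff] at hu
  set γ : ι → E := fun j => ∫ τ in a..b, p j τ • gradient H (u τ) with hγ
  have hderiv (c : ℝ) : HasDerivAt (fun c => H (u c))
      (h * ∑ j ∈ t, inner ℝ (L (γ j)) (p j c • gradient H (u c))) c := by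
    have hd := (hH.differentiable one_ne_zero (u c)).hasGradientAt.hasFDerivAt.comp_hasDerivAt c (hu c)
    refine hd.congr_deriv ?_
    simp only [InnerProductSpace.toDual_apply_apply, inner_smul_right, inner_sum]
    simp only [real_inner_comm, hγ]
  have hcont (j : ι) : Continuous fun c => inner ℝ (L (γ j)) (p j c • gradient H (u c)) :=
    continuous_const.inner (hpg j)
  have hint := integral_eq_sub_of_hasDerivAt (a := a) (b := b) (fun c _ => hderiv c)
    ((continuous_const.mul (continuous_finsetSum _ fun j _ => hcont j)).intervalIntegrable a b)
  have hterm (j : ι) : ∫ c in a..b, inner ℝ (L (γ j)) (p j c • gradient H (u c)) = 0 := by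
    have hcomm := (innerSL ℝ (L (γ j))).intervalIntegral_comp_comm
      ((hpg j).intervalIntegrable (μ := volume) a b)
    simp only [innerSL_apply_apply] at hcomm
    rw [hcomm, real_inner_comm]
    exact hL (γ j)
  rw [intervalIntegral.integral_const_mul,
    intervalIntegral.integral_finsetSum fun j _ => (hcont j).intervalIntegrable a b,
    Finset.sum_eq_zero fun j _ => hterm j, mul_zero] at hint
  linarith

/-- Energy conservation of HBVM(∞,s): for the Hamiltonian system
`ẏ = J∇H(y)` with `J` skew-symmetric and `H` continuously differentiable, any
continuous `σ` satisfying the Master Functional Equation conserves the Hamiltonian: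
`H(σ(h)) = H(y₀)`. -/
theorem stmt7 (P : ℕ → Polynomial ℝ)
    (hdeg : ∀ j, (P j).degree = j)
    (hlead : ∀ j, 0 < (P j).leadingCoeff)
    (horth : ∀ i j, (∫ x in (0:ℝ)..1, (P i).eval x * (P j).eval x)
      = if i = j then 1 else 0)
    (s : ℕ) (hs : 1 ≤ s) (m : ℕ)
    (J : Matrix (Fin m) (Fin m) ℝ) (hJ : J.transpose = -J)
    (H : EuclideanSpace ℝ (Fin m) → ℝ) (hH : ContDiff ℝ 1 H)
    (f : EuclideanSpace ℝ (Fin m) → EuclideanSpace ℝ (Fin m))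
    (hfJH : ∀ y, f y = Matrix.toEuclideanLin J (gradient H y))
    (y₀ : EuclideanSpace ℝ (Fin m)) (h : ℝ) (hh : 0 < h)
    (σ : ℝ → EuclideanSpace ℝ (Fin m)) (hσ : ContinuousOn σ (Set.Icc 0 h))
    (hMFE : ∀ c ∈ Set.Icc (0:ℝ) 1,
        σ (c * h) = y₀ + h • ∑ j ∈ Finset.range s,
          (∫ x in (0:ℝ)..c, (P j).eval x)
            • ∫ τ in (0:ℝ)..1, (P j).eval τ • f (σ (τ * h))) :
    H (σ h) = H y₀ := by
  obtain ⟨γ, hγ⟩ : ∃ γ : ℕ → EuclideanSpace ℝ (Fin m),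
      ∀ j, γ j = ∫ τ in (0:ℝ)..1, (P j).eval τ • f (σ (τ * h)) := ⟨_, fun _ => rfl⟩
  simp only [← hγ] at hMFE
  obtain ⟨u, hu⟩ : ∃ u : ℝ → EuclideanSpace ℝ (Fin m), ∀ c, u c =
      y₀ + h • ∑ j ∈ Finset.range s, (∫ x in (0:ℝ)..c, (P j).eval x) • γ j := ⟨_, fun _ => rfl⟩
  simp only [← hu] at hMFE
  have hγu (j : ℕ) : γ j = ∫ τ in (0:ℝ)..1, (P j).eval τ •
      (Matrix.toEuclideanLin J).toContinuousLinearMap (gradient H (u τ)) := by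
    rw [hγ]
    refine intervalIntegral.integral_congr fun τ hτ => ?_
    rw [Set.uIcc_of_le zero_le_one] at hτ
    simp only [hMFE τ hτ, hfJH, LinearMap.coe_toContinuousLinearMap']
  have hderiv (c : ℝ) : HasDerivAt u (h • ∑ j ∈ Finset.range s, (P j).eval c • γ j) c := by
    rw [funext hu]
    refine ((HasDerivAt.fun_sum fun j _ => ?_).const_smul h).const_add y₀
    exact ((P j).continuous.integral_hasStrictDerivAt 0 c).hasDerivAt.smul_const (γ j)
  have hconst : H (u 1) = H (u 0) := by
    refine comp_eq_of_contDiff_of_hasDerivAt_sum_smul_skew hH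
      (Matrix.toEuclideanLin J).toContinuousLinearMap
      (Matrix.inner_toEuclideanLin_self_eq_zero hJ)
      (Finset.range s) (p := fun j x => (P j).eval x) (fun j => (P j).continuous) 0 1 h u
      fun c => ?_
    simp only [← hγu]
    exact hderiv c
  have hu1 : σ h = u 1 := by simpa only [one_mul] using hMFE 1 (by simp)
  have hu0 : u 0 = y₀ := by simp [hu]
  rw [hu1, hconst, hu0]
end

section
/- Let s ≥ 1 be an integer, f : ℝ^m → ℝ^m continuous, q₀, p₀ ∈ ℝ^m, h > 0, and let σ, π : [0,h] → ℝ^m be continuous and satisfy, for all c ∈ [0,1], the coupled stage equations σ(ch) = q₀ + h ∫₀¹ a^{(s)}_{cτ} π(τh) dτ and π(ch) = p₀ + h ∫₀¹ a^{(s)}_{cτ} f(σ(τh)) dτ, where a^{(s)}_{cτ} := Σ_{j=0}^{s−1} (∫₀^c P_j(x) dx) P_j(τ). Then σ satisfies the continuous-stage Runge–Kutta–Nyström stage equation σ(ch) = q₀ + c h p₀ + h² ∫₀¹ ā^{(s)}_{cτ} f(σ(τh)) dτ for all c ∈ [0,1], where ā^{(s)}_{cτ} := Σ_{i=0}^{s−1}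 Σ_{j=0}^{s−1} (∫₀^c P_i(x) dx) (∫₀¹ P_i(ξ)(∫₀^ξ P_j(x) dx) dξ) P_j(τ). -/
open MeasureTheory intervalIntegral Finset

theorem Polynomial.continuous_primitive (p : Polynomial ℝ) :
    Continuous fun c : ℝ => ∫ x in (0:ℝ)..c, p.eval x :=
  intervalIntegral.continuous_primitive (fun a b => p.continuous.intervalIntegrable a b) 0

theorem intervalIntegral_sum_mul_smul {ι E : Type*} [NormedAddCommGroup E] [NormedSpace ℝ E]
    (S : Finset ι) (w : ι → ℝ) {p : ι → ℝ → ℝ} (hp : ∀ j ∈ S, Continuous (p j))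
    {a b : ℝ} {g : ℝ → E} (hg : ContinuousOn g (Set.uIcc a b)) :
    (∫ τ in a..b, (∑ j ∈ S, w j * p j τ) • g τ) = ∑ j ∈ S, w j • ∫ τ in a..b, p j τ • g τ := by
  simp_rw [Finset.sum_smul, mul_smul]
  rw [intervalIntegral.integral_finsetSum]
  · simp_rw [intervalIntegral.integral_smul]
  · exact fun j hj => (((hp j hj).continuousOn.smul hg).intervalIntegrable).smul (w j)

/-- The constant member of an orthonormal polynomial family on `[0,1]` is `1`. -/
theorem Polynomial.eq_one_of_degree_eq_zero_of_integral_sq {p : Polynomial ℝ}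
    (hdeg : p.degree = 0) (hlead : 0 < p.leadingCoeff)
    (hnorm : (∫ x in (0:ℝ)..1, p.eval x * p.eval x) = 1) : p = 1 := by
  obtain ⟨k, rfl⟩ : ∃ k, p = Polynomial.C k := ⟨_, Polynomial.eq_C_of_degree_eq_zero hdeg⟩
  rw [Polynomial.leadingCoeff_C] at hlead
  simp only [Polynomial.eval_C, intervalIntegral.integral_const, sub_zero, one_smul] at hnorm
  have hk : k = 1 := by nlinarith
  rw [hk, Polynomial.C_1]

/-- If `σ, π` satisfy the coupled stage equations of HBVM(∞,s)
applied to `q̇ = p`, `ṗ = f(q)`, then `σ` satisfies the continuous-stage RKN stage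
equation `σ(ch) = q₀ + c h p₀ + h² ∫₀¹ ā^{(s)}_{cτ} f(σ(τh)) dτ`. -/
theorem stmt13 (P : ℕ → Polynomial ℝ)
    (hdeg : ∀ j, (P j).degree = j)
    (hlead : ∀ j, 0 < (P j).leadingCoeff)
    (horth : ∀ i j, (∫ x in (0:ℝ)..1, (P i).eval x * (P j).eval x)
      = if i = j then 1 else 0)
    (s : ℕ) (hs : 1 ≤ s) (m : ℕ)
    (f : EuclideanSpace ℝ (Fin m) → EuclideanSpace ℝ (Fin m)) (hf : Continuous f)
    (q₀ p₀ : EuclideanSpace ℝ (Fin m)) (h : ℝ) (hh : 0 < h)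
    (σ π : ℝ → EuclideanSpace ℝ (Fin m))
    (hσ : ContinuousOn σ (Set.Icc 0 h)) (hπ : ContinuousOn π (Set.Icc 0 h))
    (hstage₁ : ∀ c ∈ Set.Icc (0:ℝ) 1,
        σ (c * h) = q₀ + h • ∫ τ in (0:ℝ)..1,
          (∑ j ∈ Finset.range s, (∫ x in (0:ℝ)..c, (P j).eval x) * (P j).eval τ)
            • π (τ * h))
    (hstage₂ : ∀ c ∈ Set.Icc (0:ℝ) 1,
        π (c * h) = p₀ + h • ∫ τ in (0:ℝ)..1,
          (∑ j ∈ Finset.range s, (∫ x in (0:ℝ)..c, (P j).eval x) * (P j).eval τ)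
            • f (σ (τ * h))) :
    ∀ c ∈ Set.Icc (0:ℝ) 1,
      σ (c * h) = q₀ + (c * h) • p₀ + (h^2) • ∫ τ in (0:ℝ)..1,
        (∑ i ∈ Finset.range s, ∑ j ∈ Finset.range s,
          (∫ x in (0:ℝ)..c, (P i).eval x) *
          (∫ ξ in (0:ℝ)..1, (P i).eval ξ * ∫ x in (0:ℝ)..ξ, (P j).eval x) *
          (P j).eval τ) • f (σ (τ * h)) := by
  have hP0 : P 0 = 1 := Polynomial.eq_one_of_degree_eq_zero_of_integral_sq
    (by simpa using hdeg 0) (hlead 0) (by simpa using horth 0 0)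
  have hint (i : ℕ) : (∫ x in (0:ℝ)..1, (P i).eval x) = if i = 0 then 1 else 0 := by
    simpa [hP0] using horth i 0
  have hmaps : Set.MapsTo (fun τ : ℝ => τ * h) (Set.uIcc 0 1) (Set.Icc 0 h) := by
    intro τ hτ
    rw [Set.uIcc_of_le zero_le_one] at hτ
    exact ⟨mul_nonneg hτ.1 hh.le, mul_le_of_le_one_left hh.le hτ.2⟩
  have hscale : ContinuousOn (fun τ : ℝ => τ * h) (Set.uIcc 0 1) := by fun_prop
  have hπ' : ContinuousOn (fun τ => π (τ * h)) (Set.uIcc 0 1) := hπ.comp hscale hmaps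
  have hg : ContinuousOn (fun τ => f (σ (τ * h))) (Set.uIcc 0 1) :=
    hf.comp_continuousOn (hσ.comp hscale hmaps)
  have hP (j : ℕ) : Continuous fun x => (P j).eval x := (P j).continuous
  set A : ℕ → ℝ → ℝ := fun j c => ∫ x in (0:ℝ)..c, (P j).eval x with hA
  have hAc (j : ℕ) : Continuous (A j) := (P j).continuous_primitive
  set G : ℕ → EuclideanSpace ℝ (Fin m) :=
    fun j => ∫ τ in (0:ℝ)..1, (P j).eval τ • f (σ (τ * h)) with hG
  have hπG : ∀ c ∈ Set.Icc (0:ℝ) 1, π (c * h) = p₀ + h • ∑ j ∈ Finset.range s, A j c • G j := by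
    intro c hc
    rw [hstage₂ c hc, intervalIntegral_sum_mul_smul _ (fun j => A j c) (fun j _ => hP j) hg]
  have hmoment (i : ℕ) : (∫ τ in (0:ℝ)..1, (P i).eval τ • π (τ * h)) =
      (if i = 0 then (1:ℝ) else 0) • p₀ + h • ∑ j ∈ Finset.range s,
        (∫ ξ in (0:ℝ)..1, (P i).eval ξ * A j ξ) • G j := by
    have hcongr : Set.EqOn (fun τ => (P i).eval τ • π (τ * h))
        (fun τ => (P i).eval τ • p₀ +
          h • ∑ j ∈ Finset.range s, ((P i).eval τ * A j τ) • G j) (Set.uIcc 0 1) := by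
      intro τ hτ
      rw [Set.uIcc_of_le zero_le_one] at hτ
      simp only [hπG τ hτ, smul_add, mul_smul, Finset.smul_sum, smul_comm _ h]
    have hterm (j : ℕ) : Continuous fun τ => ((P i).eval τ * A j τ) • G j :=
      ((hP i).mul (hAc j)).smul continuous_const
    rw [intervalIntegral.integral_congr hcongr, intervalIntegral.integral_add,
      intervalIntegral.integral_smul_const, hint, intervalIntegral.integral_smul,
      intervalIntegral.integral_finsetSum fun j _ => (hterm j).intervalIntegrable _ _]
    · simp_rw [intervalIntegral.integral_smul_const]
    · exact ((hP i).smul continuous_const).intervalIntegrable _ _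
    · exact ((continuous_finsetSum _ fun j _ => hterm j).const_smul h).intervalIntegrable _ _
  intro c hc
  have hA0 : A 0 c = c := by simp [hA, hP0]
  have hconst : (∑ i ∈ Finset.range s, A i c • (if i = 0 then (1:ℝ) else 0) • p₀) = c • p₀ := by
    rw [Finset.sum_eq_single_of_mem 0 (Finset.mem_range.2 hs)]
    · simp [hA0]
    · intro i _ hi
      simp [hi]
  have hkernel : (∫ τ in (0:ℝ)..1, (∑ i ∈ Finset.range s, ∑ j ∈ Finset.range s,
        A i c * (∫ ξ in (0:ℝ)..1, (P i).eval ξ * A j ξ) * (P j).eval τ) • f (σ (τ * h))) =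
      ∑ i ∈ Finset.range s, A i c • ∑ j ∈ Finset.range s,
        (∫ ξ in (0:ℝ)..1, (P i).eval ξ * A j ξ) • G j := by
    simp_rw [← Finset.sum_product']
    rw [intervalIntegral_sum_mul_smul (p := fun x : ℕ × ℕ => fun τ => (P x.2).eval τ) _
      (fun x : ℕ × ℕ => A x.1 c * ∫ ξ in (0:ℝ)..1, (P x.1).eval ξ * A x.2 ξ)
      (fun x _ => hP x.2) hg, Finset.sum_product]
    simp_rw [Finset.smul_sum, mul_smul, hG]
  rw [hkernel, hstage₁ c hc,
    intervalIntegral_sum_mul_smul _ (fun j => A j c) (fun j _ => hP j) hπ']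
  simp_rw [hmoment, smul_add, Finset.sum_add_distrib, hconst, smul_comm _ h, ← Finset.smul_sum]
  rw [smul_add, smul_smul, smul_smul, mul_comm h c, ← pow_two, add_assoc]
end

section
/- Let s ≥ 2 be an integer, f : ℝ^m → ℝ^m continuous, q₀, p₀ ∈ ℝ^m, h > 0, and let σ, π : [0,h] → ℝ^m be continuous and satisfy, for all c ∈ [0,1], the coupled stage equations σ(ch) = q₀ + h ∫₀¹ a^{(s)}_{cτ} π(τh) dτ and π(ch) = p₀ + h ∫₀¹ a^{(s)}_{cτ} f(σ(τh)) dτ, where a^{(s)}_{cτ} := Σ_{j=0}^{s−1} (∫₀^c P_j(x) dx) P_j(τ). Then the updates q₁ := σ(h) and q̇₁ := π(h) satisfy q₁ = q₀ + h p₀ + h² ∫₀¹ (1 − c) f(σ(ch)) dc and q̇₁ = p₀ + h ∫₀¹ f(σ(ch)) dc. -/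
open MeasureTheory intervalIntegral Finset

theorem Polynomial.exists_eq_sum_C_mul_of_degree_lt {K : Type*} [Field K]
    {P : ℕ → Polynomial K} (hdeg : ∀ j, (P j).degree = j) (s : ℕ) :
    ∀ r : Polynomial K, r.degree < s →
      ∃ a : ℕ → K, r = ∑ j ∈ range s, Polynomial.C (a j) * P j := by
  induction s with
  | zero =>
    intro r hr
    refine ⟨0, ?_⟩
    simpa [Nat.WithBot.lt_zero_iff] using hr
  | succ n ih =>
    intro r hr
    have hne : P n ≠ 0 := by
      intro h0
      simpa [h0] using hdeg n
    have hlc : (P n).leadingCoeff ≠ 0 := Polynomial.leadingCoeff_ne_zero.mpr hne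
    have hnat : (P n).natDegree = n := Polynomial.natDegree_eq_of_degree_eq_some (hdeg n)
    set b := r.coeff n / (P n).leadingCoeff with hb
    obtain ⟨a, ha⟩ := ih (r - Polynomial.C b * P n) (by
      rw [Polynomial.degree_lt_iff_coeff_zero]
      intro k hk
      rcases hk.eq_or_lt with rfl | hk
      · have : (P n).coeff n = (P n).leadingCoeff := by rw [Polynomial.leadingCoeff, hnat]
        rw [Polynomial.coeff_sub, Polynomial.coeff_C_mul, this, hb, div_mul_cancel₀ _ hlc, sub_self]
      · rw [Polynomial.coeff_sub, Polynomial.coeff_C_mul,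
          Polynomial.coeff_eq_zero_of_natDegree_lt (p := P n) (by omega),
          (Polynomial.degree_lt_iff_coeff_zero r (n + 1)).mp hr k hk]
        simp)
    refine ⟨Function.update a n b, ?_⟩
    rw [sum_range_succ, Function.update_self, ← sub_eq_iff_eq_add, ha]
    refine sum_congr rfl fun j hj => ?_
    rw [Function.update_of_ne (mem_range.mp hj).ne]

/-- A polynomial of degree less than `s` equals its orthonormal expansion of length `s`. -/
theorem Polynomial.sum_integral_mul_eval_eq_of_degree_lt {P : ℕ → Polynomial ℝ}
    (hdeg : ∀ j, (P j).degree = j)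
    (horth : ∀ i j, (∫ x in (0 : ℝ)..1, (P i).eval x * (P j).eval x) = if i = j then 1 else 0)
    {s : ℕ} {r : Polynomial ℝ} (hr : r.degree < s) (t : ℝ) :
    ∑ j ∈ range s, (∫ x in (0 : ℝ)..1, r.eval x * (P j).eval x) * (P j).eval t = r.eval t := by
  obtain ⟨a, rfl⟩ := Polynomial.exists_eq_sum_C_mul_of_degree_lt hdeg s r hr
  rw [Polynomial.eval_finsetSum]
  refine sum_congr rfl fun j hj => ?_
  simp only [Polynomial.eval_finsetSum, Polynomial.eval_mul, Polynomial.eval_C, sum_mul, mul_assoc]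
  rw [intervalIntegral.integral_finsetSum fun i _ =>
    Continuous.intervalIntegrable (by fun_prop) _ _]
  simp only [intervalIntegral.integral_const_mul, horth]
  rw [sum_eq_single_of_mem j hj fun i _ hij => by simp [hij]]
  simp

theorem Polynomial.integral_integral_eval (p : Polynomial ℝ) :
    (∫ c in (0 : ℝ)..1, ∫ x in (0 : ℝ)..c, p.eval x) =
      ∫ x in (0 : ℝ)..1, (1 - x) * p.eval x := by
  have hp : Continuous fun x => p.eval x := p.continuous
  have hu : ∀ x ∈ Set.uIcc (0 : ℝ) 1, HasDerivAt (fun x : ℝ => 1 - x) (-1) x := fun x _ => by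
    simpa using (hasDerivAt_id x).const_sub 1
  have hv : ∀ x ∈ Set.uIcc (0 : ℝ) 1,
      HasDerivAt (fun c => ∫ x in (0 : ℝ)..c, p.eval x) (p.eval x) x := fun x _ =>
    hp.integral_hasStrictDerivAt 0 x |>.hasDerivAt
  rw [integral_mul_deriv_eq_deriv_mul hu hv (by simp) (hp.intervalIntegrable _ _)]
  simp

theorem integral_sum_mul_smul {E : Type*} [NormedAddCommGroup E] [NormedSpace ℝ E]
    {P : ℕ → Polynomial ℝ} {g : ℝ → E} (hg : ContinuousOn g (Set.Icc 0 1)) (s : ℕ) (a : ℕ → ℝ) :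
    (∫ τ in (0 : ℝ)..1, (∑ j ∈ range s, a j * (P j).eval τ) • g τ) =
      ∑ j ∈ range s, a j • ∫ τ in (0 : ℝ)..1, (P j).eval τ • g τ := by
  simp only [sum_smul, mul_smul]
  rw [intervalIntegral.integral_finsetSum]
  · simp only [intervalIntegral.integral_smul]
  · intro j _
    refine ContinuousOn.intervalIntegrable ?_
    rw [Set.uIcc_of_le zero_le_one]
    exact ((P j).continuous.continuousOn.smul hg).const_smul (a j)

/-- If `σ, π` satisfy the coupled stage equations of HBVM(∞,s)
(`s ≥ 2`) applied to `q̇ = p`, `ṗ = f(q)`, then the updates `q₁ := σ(h)` and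
`q̇₁ := π(h)` satisfy `q₁ = q₀ + h p₀ + h² ∫₀¹ (1−c) f(σ(ch)) dc` and
`q̇₁ = p₀ + h ∫₀¹ f(σ(ch)) dc`. -/
theorem stmt15 (P : ℕ → Polynomial ℝ)
    (hdeg : ∀ j, (P j).degree = j)
    (hlead : ∀ j, 0 < (P j).leadingCoeff)
    (horth : ∀ i j, (∫ x in (0:ℝ)..1, (P i).eval x * (P j).eval x)
      = if i = j then 1 else 0)
    (s : ℕ) (hs : 2 ≤ s) (m : ℕ)
    (f : EuclideanSpace ℝ (Fin m) → EuclideanSpace ℝ (Fin m)) (hf : Continuous f)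
    (q₀ p₀ : EuclideanSpace ℝ (Fin m)) (h : ℝ) (hh : 0 < h)
    (σ π : ℝ → EuclideanSpace ℝ (Fin m))
    (hσ : ContinuousOn σ (Set.Icc 0 h)) (hπ : ContinuousOn π (Set.Icc 0 h))
    (hstage₁ : ∀ c ∈ Set.Icc (0:ℝ) 1,
        σ (c * h) = q₀ + h • ∫ τ in (0:ℝ)..1,
          (∑ j ∈ Finset.range s, (∫ x in (0:ℝ)..c, (P j).eval x) * (P j).eval τ)
            • π (τ * h))
    (hstage₂ : ∀ c ∈ Set.Icc (0:ℝ) 1,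
        π (c * h) = p₀ + h • ∫ τ in (0:ℝ)..1,
          (∑ j ∈ Finset.range s, (∫ x in (0:ℝ)..c, (P j).eval x) * (P j).eval τ)
            • f (σ (τ * h))) :
    σ h = q₀ + h • p₀ + (h^2) • (∫ c in (0:ℝ)..1, (1 - c) • f (σ (c * h))) ∧
    π h = p₀ + h • ∫ c in (0:ℝ)..1, f (σ (c * h)) := by
  have hmaps : Set.MapsTo (fun t : ℝ => t * h) (Set.Icc 0 1) (Set.Icc 0 h) := fun t ht =>
    ⟨mul_nonneg ht.1 hh.le, mul_le_of_le_one_left hh.le ht.2⟩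
  have hg : ContinuousOn (fun t => f (σ (t * h))) (Set.Icc 0 1) :=
    hf.comp_continuousOn (hσ.comp (by fun_prop) hmaps)
  have hone (τ : ℝ) :
      ∑ j ∈ range s, (∫ x in (0 : ℝ)..1, (P j).eval x) * (P j).eval τ = 1 := by
    simpa using Polynomial.sum_integral_mul_eval_eq_of_degree_lt hdeg horth
      (r := 1) (s := s) (by rw [Polynomial.degree_one]; exact_mod_cast (by omega : 0 < s)) τ
  have hlin (τ : ℝ) :
      ∑ j ∈ range s, (∫ c in (0 : ℝ)..1, ∫ x in (0 : ℝ)..c, (P j).eval x) * (P j).eval τ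
        = 1 - τ := by
    have hdeg_lin : (1 - Polynomial.X : Polynomial ℝ).degree < s :=
      (Polynomial.degree_sub_le _ _).trans_lt <| by
        rw [Polynomial.degree_one, Polynomial.degree_X]
        exact max_lt (by exact_mod_cast (by omega : 0 < s)) (by exact_mod_cast (by omega : 1 < s))
    simpa [Polynomial.integral_integral_eval] using
      Polynomial.sum_integral_mul_eval_eq_of_degree_lt hdeg horth hdeg_lin τ
  have hπ_int : ∫ c in (0 : ℝ)..1, π (c * h) =
      p₀ + h • ∫ c in (0 : ℝ)..1, (1 - c) • f (σ (c * h)) := by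
    have hQ (j : ℕ) : Continuous fun c : ℝ => ∫ x in (0 : ℝ)..c, (P j).eval x :=
      continuous_primitive (fun _ _ => (P j).continuous.intervalIntegrable _ _) 0
    have hstage : Set.EqOn (fun c => π (c * h)) (fun c => p₀ + h • ∑ j ∈ range s,
        (∫ x in (0 : ℝ)..c, (P j).eval x) •
          ∫ τ in (0 : ℝ)..1, (P j).eval τ • f (σ (τ * h))) (Set.uIcc 0 1) := by
      intro c hc
      rw [Set.uIcc_of_le zero_le_one] at hc
      simp only [hstage₂ c hc, integral_sum_mul_smul hg]
    rw [intervalIntegral.integral_congr hstage, intervalIntegral.integral_add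
      (by simp) (Continuous.intervalIntegrable (by fun_prop) _ _),
      intervalIntegral.integral_smul, intervalIntegral.integral_finsetSum
        fun j _ => Continuous.intervalIntegrable (by fun_prop) _ _]
    simp only [intervalIntegral.integral_smul_const, ← integral_sum_mul_smul hg, hlin]
    simp
  have hσ₁ := hstage₁ 1 (by simp)
  have hπ₁ := hstage₂ 1 (by simp)
  simp only [hone, one_mul, one_smul] at hσ₁ hπ₁
  refine ⟨?_, hπ₁⟩
  rw [hσ₁, hπ_int, smul_add, smul_smul, ← sq, add_assoc]
end
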